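/- Let X be a Banach space, T = D + S a bounded operator with S strictly singular, and λ ∈ σ(T) with λ ∉ σ_p(T) ∪ {0}. Then λ ∈ σ(D). (Equivalently: σ(T) \ (σ_p(T) ∪ {0}) ⊆ σ(D).) -/

import Mathlib

/-- A bounded operator is strictly singular if its restriction to every
infinite-dimensional closed subspace fails to be an isomorphism onto its range
(equivalently, is not bounded below). -/
def StrictlySingular {X Y : Type*}
    [NormedAddCommGroup X] [NormedSpace ℂ X]
    [NormedAddCommGroup Y] [NormedSpace ℂ Y]
    (S : X →L[ℂ] Y) : Prop :=
  ∀ Z : Submodule ℂ X, IsClosed (Z : Set X) → ¬ FiniteDimensional ℂ Z →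
    ¬ ∃ c : ℝ, 0 < c ∧ ∀ z : Z, c * ‖(z : X)‖ ≤ ‖S (z : X)‖

namespace SSAux

variable {X : Type*} [NormedAddCommGroup X] [NormedSpace ℂ X]

/-- Triangular estimate for the coefficients. -/
lemma coeff_bound (x : ℕ → X) (f : ℕ → (X →L[ℂ] ℂ)) (hx : ∀ n, ‖x n‖ = 1)
    (hf : ∀ n, ‖f n‖ ≤ 1) (hfx : ∀ n, f n (x n) = 1) (hz : ∀ m n, m < n → f m (x n) = 0)
    (a : ℕ → ℂ) (N : ℕ) (n : ℕ) (hn : n < N) :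
    ‖a n‖ ≤ 2 ^ n * ‖∑ i ∈ Finset.range N, a i • x i‖ := by
  induction n using Nat.strong_induction_on with
  | _ n ih =>
    set z := ∑ i ∈ Finset.range N, a i • x i with hzdef
    have h1 : f n z = ∑ i ∈ Finset.range (n + 1), a i * f n (x i) := by
      rw [hzdef, map_sum]
      simp only [map_smul, smul_eq_mul]
      symm
      apply Finset.sum_subset
      · intro i hi
        simp only [Finset.mem_range] at *
        omega
      · intro i _ hi
        simp only [Finset.mem_range] at hi
        rw [hz n i (by omega), mul_zero]
    rw [Finset.sum_range_succ, hfx, mul_one] at h1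
    have h2 : a n = f n z - ∑ i ∈ Finset.range n, a i * f n (x i) := by rw [h1]; ring
    have hb : ∀ y, ‖f n y‖ ≤ ‖y‖ := fun y => by
      calc ‖f n y‖ ≤ ‖f n‖ * ‖y‖ := (f n).le_opNorm y
        _ ≤ 1 * ‖y‖ := by gcongr; exact hf n
        _ = ‖y‖ := one_mul _
    have hg : (1 : ℝ) + ∑ i ∈ Finset.range n, (2 : ℝ) ^ i = 2 ^ n := by
      have := geom_sum_eq (by norm_num : (2 : ℝ) ≠ 1) n
      rw [this]; ring
    calc ‖a n‖ ≤ ‖f n z‖ + ‖∑ i ∈ Finset.range n, a i * f n (x i)‖ := by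
          rw [h2]; exact norm_sub_le _ _
      _ ≤ ‖z‖ + ∑ i ∈ Finset.range n, 2 ^ i * ‖z‖ := by
          gcongr
          · exact hb z
          · refine (norm_sum_le _ _).trans (Finset.sum_le_sum fun i hi => ?_)
            have hi' := Finset.mem_range.1 hi
            rw [norm_mul]
            calc ‖a i‖ * ‖f n (x i)‖ ≤ ‖a i‖ * 1 := by
                  gcongr
                  exact (hb _).trans (hx i).le
              _ = ‖a i‖ := mul_one _
              _ ≤ _ := ih i hi' (hi'.trans hn)
      _ = 2 ^ n * ‖z‖ := by rw [← Finset.sum_mul, ← hg]; ring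

/-- bounded below on a closed subspace of finite codimension -/
def USF (A : X →L[ℂ] X) : Prop :=
  ∃ M : Submodule ℂ X, IsClosed (M : Set X) ∧ M.CoFG ∧
    ∃ c : ℝ, 0 < c ∧ ∀ x ∈ M, c * ‖x‖ ≤ ‖A x‖

/-- finite rank -/
def FR (R : X →L[ℂ] X) : Prop := (LinearMap.ker (R : X →ₗ[ℂ] X)).CoFG

/-- finite rank perturbation of an invertible operator -/
def FZ (A : X →L[ℂ] X) : Prop := ∃ R : X →L[ℂ] X, FR R ∧ IsUnit (A + R)

lemma FR.add {R R' : X →L[ℂ] X} (h : FR R) (h' : FR R') : FR (R + R') := by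
  refine Submodule.CoFG.of_le ?_ (Submodule.CoFG.inf h h')
  intro x hx
  simp only [Submodule.mem_inf, LinearMap.mem_ker, ContinuousLinearMap.coe_coe] at hx ⊢
  simp [hx.1, hx.2]

lemma FR.neg {R : X →L[ℂ] X} (h : FR R) : FR (-R) := by
  refine Submodule.CoFG.of_le ?_ h
  intro x hx
  simp only [LinearMap.mem_ker, ContinuousLinearMap.coe_coe] at hx ⊢
  simp [hx]

lemma FR.comp {R : X →L[ℂ] X} (h : FR R) (V : X →L[ℂ] X) : FR (V * R) := by
  refine Submodule.CoFG.of_le ?_ h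
  intro x hx
  simp only [LinearMap.mem_ker, ContinuousLinearMap.coe_coe] at hx ⊢
  simp [hx]

lemma FR.smulRight (φ : X →L[ℂ] ℂ) (y : X) : FR (φ.smulRight y) := by
  refine Submodule.CoFG.of_le (S := LinearMap.ker (φ : X →ₗ[ℂ] ℂ)) ?_ (Submodule.CoFG.ker _)
  intro x hx
  simp only [LinearMap.mem_ker, ContinuousLinearMap.coe_coe] at hx ⊢
  simp [hx]

lemma FZ.add {A R : X →L[ℂ] X} (h : FZ A) (hR : FR R) : FZ (A + R) := by
  obtain ⟨R', h1, h2⟩ := h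
  refine ⟨R' + -R, h1.add hR.neg, ?_⟩
  convert h2 using 1
  abel

lemma USF.add {A R : X →L[ℂ] X} (h : USF A) (hR : FR R) : USF (A + R) := by
  obtain ⟨M, h1, h2, c, hc, h3⟩ := h
  refine ⟨M ⊓ LinearMap.ker (R : X →ₗ[ℂ] X), ?_, Submodule.CoFG.inf h2 hR, c, hc, ?_⟩
  · exact h1.inter (ContinuousLinearMap.isClosed_ker R)
  · intro x hx
    have : R x = 0 := hx.2
    simpa [this] using h3 x hx.1

/-- The Fredholm alternative for identity minus finite rank. -/
lemma alt_one_sub {F : X →L[ℂ] X} (hF : FR F) :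
    Function.Injective (1 - F : X →L[ℂ] X) ↔ Function.Surjective (1 - F : X →L[ℂ] X) := by
  let E := LinearMap.range (F : X →ₗ[ℂ] X)
  have hE : FiniteDimensional ℂ E :=
    Module.Finite.iff_fg.2 (Submodule.range_fg_iff_ker_cofg.2 hF)
  have hmaps : ∀ x ∈ E, (((1 - F : X →L[ℂ] X)) : X →ₗ[ℂ] X) x ∈ E := by
    intro x hx
    exact E.sub_mem hx ⟨x, rfl⟩
  let G : E →ₗ[ℂ] E := ((1 - F : X →L[ℂ] X) : X →ₗ[ℂ] X).restrict hmaps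
  have hG : ∀ e : E, (G e : X) = (1 - F : X →L[ℂ] X) e := fun e => rfl
  have hiff : Function.Injective G ↔ Function.Surjective G := LinearMap.injective_iff_surjective
  constructor
  · intro hi
    have : Function.Injective G := by
      intro a b hab
      apply Subtype.ext
      apply hi
      rw [← hG, ← hG, hab]
    intro x
    obtain ⟨w, hw⟩ := hiff.1 this ⟨F x, ⟨x, rfl⟩⟩
    refine ⟨x + w, ?_⟩
    rw [map_add, ← hG w, hw]
    simp
  · intro hs
    have : Function.Surjective G := by
      intro y
      obtain ⟨x, hx⟩ := hs y
      have hx' : x = y + F x := by rw [← hx]; simp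
      have hxE : x ∈ E := by
        rw [hx']
        exact E.add_mem y.2 ⟨x, rfl⟩
      exact ⟨⟨x, hxE⟩, Subtype.ext hx⟩
    have hi := hiff.2 this
    rw [injective_iff_map_eq_zero]
    intro x hx
    have hx' : x = F x := by
      have : x - F x = 0 := by simpa using hx
      exact sub_eq_zero.1 this
    have hxE : x ∈ E := ⟨x, hx'.symm⟩
    have h0 : G ⟨x, hxE⟩ = 0 := Subtype.ext hx
    have := (injective_iff_map_eq_zero G).1 hi _ h0
    exact congrArg Subtype.val this

lemma FZ.alt {A : X →L[ℂ] X} (h : FZ A) : Function.Injective A ↔ Function.Surjective A := by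
  obtain ⟨R, hR, u, hu⟩ := h
  have key := alt_one_sub (hR.comp (↑u⁻¹ : X →L[ℂ] X))
  have hA : A = (u : X →L[ℂ] X) * (1 - (↑u⁻¹ : X →L[ℂ] X) * R) := by
    rw [mul_sub, ← mul_assoc, Units.mul_inv, mul_one, one_mul, hu]
    abel
  have h1 : ∀ x, (↑u⁻¹ : X →L[ℂ] X) ((u : X →L[ℂ] X) x) = x := fun x => by
    rw [← mul_apply_eq_comp, Units.inv_mul]; rfl
  have h2 : ∀ x, (u : X →L[ℂ] X) ((↑u⁻¹ : X →L[ℂ] X) x) = x := fun x => by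
    rw [← mul_apply_eq_comp, Units.mul_inv]; rfl
  have hbij : Function.Bijective (u : X →L[ℂ] X) :=
    ⟨Function.LeftInverse.injective h1, Function.RightInverse.surjective h2⟩
  have hA' : (A : X → X) = (u : X →L[ℂ] X) ∘ (1 - (↑u⁻¹ : X →L[ℂ] X) * R : X →L[ℂ] X) := by
    conv_lhs => rw [hA]
    rfl
  rw [hA', hbij.1.of_comp_iff, Function.Surjective.of_comp_iff' hbij]
  exact key

variable [CompleteSpace X]

lemma isOpen_FZ : IsOpen {A : X →L[ℂ] X | FZ A} := by
  have : {A : X →L[ℂ] X | FZ A} =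
      ⋃ R ∈ {R : X →L[ℂ] X | FR R}, (fun A => A + R) ⁻¹' {B | IsUnit B} := by
    ext A
    simp [FZ]
  rw [this]
  exact isOpen_biUnion fun R _ => Units.isOpen.preimage (by fun_prop)

lemma USF.finite_ker {A : X →L[ℂ] X} (h : USF A) :
    FiniteDimensional ℂ (LinearMap.ker (A : X →ₗ[ℂ] X)) := by
  obtain ⟨M, h1, h2, c, hc, h3⟩ := h
  refine Module.Finite.iff_fg.2 (Submodule.CoFG.fg_of_disjoint (T := M) (Disjoint.symm ?_) h2)
  rw [Submodule.disjoint_def]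
  intro x hx hk
  have hk' : A x = 0 := hk
  have := h3 x hx
  rw [hk', norm_zero] at this
  have : ‖x‖ ≤ 0 := by
    by_contra hne
    push Not at hne
    have := mul_pos hc hne
    linarith
  exact norm_le_zero_iff.1 this

lemma USF.below {A : X →L[ℂ] X} (h : USF A) (hi : Function.Injective A) :
    ∃ c : ℝ, 0 < c ∧ ∀ x, c * ‖x‖ ≤ ‖A x‖ := by
  obtain ⟨M, h1, h2, c, hc, h3⟩ := h
  obtain ⟨N, hN⟩ := M.exists_isCompl
  have hNf : FiniteDimensional ℂ N := Module.Finite.iff_fg.2 (h2.fg_of_isCompl hN)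
  have : CompleteSpace M := h1.completeSpace_coe
  have hcl : IsClosed ((M.map (A : X →ₗ[ℂ] X) : Submodule ℂ X) : Set X) := by
    have hal : AntilipschitzWith (Real.toNNReal c⁻¹) (A.comp M.subtypeL) := by
      apply AddMonoidHomClass.antilipschitz_of_bound
      intro x
      have := h3 x x.2
      rw [Real.coe_toNNReal _ (by positivity)]
      rw [inv_mul_eq_div, le_div_iff₀ hc, mul_comm]
      exact this
    have := hal.isClosed_range (A.comp M.subtypeL).uniformContinuous
    convert this using 1
    ext y
    simp
  have hr : IsClosed (Set.range A) := by
    have h4 := Submodule.isClosed_sup_finiteDimensional _ (N.map (A : X →ₗ[ℂ] X)) hcl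
    rw [← Submodule.map_sup, hN.sup_eq_top, Submodule.map_top] at h4
    exact h4
  obtain ⟨K, hK⟩ := A.antilipschitz_of_injective_of_isClosed_range hi hr
  refine ⟨(K + 1 : ℝ)⁻¹, by positivity, fun x => ?_⟩
  have h5 := hK.le_mul_dist x 0
  simp only [map_zero, dist_zero_right] at h5
  rw [inv_mul_eq_div, div_le_iff₀ (by positivity)]
  nlinarith [norm_nonneg (A x)]

/-- limit of finite rank perturbations of units, upper semi-Fredholm -/
lemma FZ.of_closure (n : ℕ) : ∀ (A : X →L[ℂ] X), USF A →
    Module.finrank ℂ (LinearMap.ker (A : X →ₗ[ℂ] X)) = n →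
    A ∈ closure {B : X →L[ℂ] X | FZ B} → FZ A := by
  induction n using Nat.strong_induction_on with
  | _ n ih =>
  intro A hA hn hcl
  have hfin := hA.finite_ker
  by_cases hi : Function.Injective A
  · obtain ⟨c, hc, hb⟩ := hA.below hi
    obtain ⟨B, hB, hd⟩ := Metric.mem_closure_iff.1 hcl (c / 4) (by positivity)
    rw [dist_eq_norm] at hd
    have hBb : ∀ x, c / 2 * ‖x‖ ≤ ‖B x‖ := fun x => by
      have h1 := hb x
      have h2 : ‖(A - B) x‖ ≤ c / 4 * ‖x‖ := (A - B).le_of_opNorm_le hd.le x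
      have h3 : ‖A x‖ ≤ ‖B x‖ + ‖(A - B) x‖ := by
        have : A x = B x + (A - B) x := by simp
        rw [this]; exact norm_add_le _ _
      nlinarith [norm_nonneg x]
    have hBi : Function.Injective B := by
      rw [injective_iff_map_eq_zero]
      intro x hx
      have := hBb x
      rw [hx, norm_zero] at this
      have : ‖x‖ ≤ 0 := by
        by_contra hne
        push Not at hne
        have := mul_pos (half_pos hc) hne
        linarith
      exact norm_le_zero_iff.1 this
    have hBu : IsUnit B := ContinuousLinearMap.isUnit_iff_bijective.2 ⟨hBi, (FZ.alt hB).1 hBi⟩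
    obtain ⟨u, hu⟩ := hBu
    have hinv : ‖(↑u⁻¹ : X →L[ℂ] X)‖ ≤ 2 / c := by
      refine ContinuousLinearMap.opNorm_le_bound _ (by positivity) fun y => ?_
      have h1 := hBb ((↑u⁻¹ : X →L[ℂ] X) y)
      rw [← hu, ← mul_apply_eq_comp, Units.mul_inv] at h1
      have h2 : (1 : X →L[ℂ] X) y = y := rfl
      rw [h2] at h1
      rw [div_mul_eq_mul_div, le_div_iff₀ hc]
      linarith
    have hlt : ‖(↑u⁻¹ : X →L[ℂ] X) * (B - A)‖ < 1 := by
      calc _ ≤ ‖(↑u⁻¹ : X →L[ℂ] X)‖ * ‖B - A‖ := norm_mul_le _ _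
        _ ≤ 2 / c * (c / 4) := by
            gcongr
            rw [norm_sub_rev]; exact hd.le
        _ < 1 := by field_simp; norm_num
    refine ⟨0, ?_, ?_⟩
    · have h0 := (FR.smulRight (0 : X →L[ℂ] ℂ) (0 : X))
      convert h0
      ext; simp
    have := u.isUnit.mul (isUnit_one_sub_of_norm_lt_one hlt)
    rw [mul_sub, ← mul_assoc, Units.mul_inv, hu] at this
    convert this using 1
    simp
  · by_cases hs : Function.Surjective A
    · -- surjective case: contradiction
      exfalso
      obtain ⟨M, hMc, hM⟩ := (Submodule.ClosedComplemented.of_finiteDimensional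
        (LinearMap.ker (A : X →ₗ[ℂ] X))).exists_isClosed_isCompl
      have : CompleteSpace M := hMc.completeSpace_coe
      have hk : LinearMap.ker ((A.comp M.subtypeL : M →L[ℂ] X) : M →ₗ[ℂ] X) = ⊥ := by
        rw [LinearMap.ker_eq_bot']
        intro m hm
        apply Subtype.ext
        exact (Submodule.disjoint_def.1 hM.disjoint) m hm m.2
      have hr : LinearMap.range ((A.comp M.subtypeL : M →L[ℂ] X) : M →ₗ[ℂ] X) = ⊤ := by
        rw [LinearMap.range_eq_top]
        intro y
        obtain ⟨x, rfl⟩ := hs y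
        have hx : x ∈ LinearMap.ker (A : X →ₗ[ℂ] X) ⊔ M := by rw [hM.sup_eq_top]; trivial
        obtain ⟨k, hk, m, hm, rfl⟩ := Submodule.mem_sup.1 hx
        have hk' : A k = 0 := hk
        exact ⟨⟨m, hm⟩, by simp [hk']⟩
      let e := ContinuousLinearEquiv.ofBijective (A.comp M.subtypeL) hk hr
      let V : X →L[ℂ] X := M.subtypeL.comp (e.symm : X →L[ℂ] M)
      have hAV : A * V = 1 := by
        ext y
        exact ContinuousLinearEquiv.ofBijective_apply_symm_apply (A.comp M.subtypeL) hk hr y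
      have hopen : IsOpen ((fun B : X →L[ℂ] X => B * V) ⁻¹' {B | IsUnit B}) :=
        Units.isOpen.preimage (by fun_prop)
      obtain ⟨B, hBV, hB⟩ := mem_closure_iff.1 hcl _ hopen (by simp [hAV])
      have hBV' : IsUnit (B * V) := hBV
      have hBs : Function.Surjective B := by
        have := (ContinuousLinearMap.isUnit_iff_bijective.1 hBV').2
        exact Function.Surjective.of_comp (g := V) this
      have hBu : IsUnit B :=
        ContinuousLinearMap.isUnit_iff_bijective.2 ⟨(FZ.alt hB).2 hBs, hBs⟩
      have hVu : IsUnit V := by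
        obtain ⟨u, rfl⟩ := hBu
        exact (Units.isUnit_units_mul u V).1 hBV'
      have hAu : IsUnit A := by
        obtain ⟨v, hv⟩ := hVu
        rw [← hv] at hAV
        rw [show A = ↑v⁻¹ from Units.eq_inv_of_mul_eq_one_right hAV]
        exact Units.isUnit _
      exact hi (ContinuousLinearMap.isUnit_iff_bijective.1 hAu).1
    · obtain ⟨y, hy⟩ := not_forall.1 hs
      rw [injective_iff_map_eq_zero] at hi
      push Not at hi
      obtain ⟨x0, hx0, hne⟩ := hi
      obtain ⟨φ, -, hφ⟩ := exists_dual_vector ℂ x0 (norm_ne_zero_iff.2 hne)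
      have hφ0 : φ x0 ≠ 0 := by rw [hφ]; exact Complex.ofReal_ne_zero.2 (norm_ne_zero_iff.2 hne)
      have hR := FR.smulRight φ y
      have hlt : LinearMap.ker ((A + φ.smulRight y : X →L[ℂ] X) : X →ₗ[ℂ] X) <
          LinearMap.ker (A : X →ₗ[ℂ] X) := by
        have hker : ∀ x, A x + φ x • y = 0 → φ x = 0 := by
          intro x hx
          by_contra hne
          apply hy
          refine ⟨-(φ x)⁻¹ • x, ?_⟩
          rw [map_smul, eq_neg_of_add_eq_zero_left hx, neg_smul, smul_neg, neg_neg, smul_smul,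
            inv_mul_cancel₀ hne, one_smul]
        refine lt_of_le_of_ne ?_ ?_
        · intro x hx
          have hx' : A x + φ x • y = 0 := hx
          have h0 := hker x hx'
          rw [h0, zero_smul, add_zero] at hx'
          exact hx'
        · intro heq
          have : x0 ∈ LinearMap.ker ((A + φ.smulRight y : X →L[ℂ] X) : X →ₗ[ℂ] X) := by
            rw [heq]; exact hx0
          exact hφ0 (hker x0 this)
      have hlt' := Submodule.finrank_lt_finrank_of_lt hlt
      rw [hn] at hlt'
      have hcl' : A + φ.smulRight y ∈ closure {B : X →L[ℂ] X | FZ B} := by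
        refine map_mem_closure (f := fun B : X →L[ℂ] X => B + φ.smulRight y) (by fun_prop) hcl ?_
        intro B hB
        exact FZ.add hB hR
      have := (ih _ hlt' _ (hA.add hR) rfl hcl').add hR.neg
      simpa using this

lemma USF.of_strictlySingular (u : (X →L[ℂ] X)ˣ) (S : X →L[ℂ] X) (hS : StrictlySingular S)
    (t : ℝ) : USF ((u : X →L[ℂ] X) + (t : ℂ) • S) := by
  classical
  by_contra hA
  set A : X →L[ℂ] X := (u : X →L[ℂ] X) + (t : ℂ) • S with hAdef
  -- lower bound for `u`
  obtain ⟨d, hd, hu⟩ : ∃ d : ℝ, 0 < d ∧ ∀ x, d * ‖x‖ ≤ ‖(u : X →L[ℂ] X) x‖ := by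
    refine ⟨(‖(↑u⁻¹ : X →L[ℂ] X)‖ + 1)⁻¹, by positivity, fun x => ?_⟩
    have h1 : (↑u⁻¹ : X →L[ℂ] X) ((u : X →L[ℂ] X) x) = x := by
      rw [← mul_apply_eq_comp, Units.inv_mul]; rfl
    have h2 := (↑u⁻¹ : X →L[ℂ] X).le_opNorm ((u : X →L[ℂ] X) x)
    rw [h1] at h2
    rw [inv_mul_eq_div, div_le_iff₀ (by positivity)]
    nlinarith [norm_nonneg ((u : X →L[ℂ] X) x)]
  obtain ⟨g, hg, hgr⟩ := exists_seq_of_forall_finset_exists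
    (α := ℕ × X × (X →L[ℂ] ℂ))
    (fun p => ‖p.2.1‖ = 1 ∧ ‖p.2.2‖ ≤ 1 ∧ p.2.2 p.2.1 = 1 ∧ ‖A p.2.1‖ ≤ d / 4 * (1 / 4) ^ p.1)
    (fun p q => p.1 < q.1 ∧ p.2.2 q.2.1 = 0) (by
      intro s _
      let n := s.sup (fun p => p.1) + 1
      let M : Submodule ℂ X := s.inf (fun p => LinearMap.ker (p.2.2 : X →ₗ[ℂ] ℂ))
      have hM : ∀ x, x ∈ M ↔ ∀ p ∈ s, p.2.2 x = 0 := by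
        intro x
        simp [M, Submodule.mem_finsetInf]
      have hMc : IsClosed (M : Set X) := by
        have : (M : Set X) = ⋂ p ∈ s, (LinearMap.ker (p.2.2 : X →ₗ[ℂ] ℂ) : Set X) := by
          ext x
          simp [hM]
        rw [this]
        exact isClosed_biInter fun p _ => ContinuousLinearMap.isClosed_ker p.2.2
      have hMf : M.CoFG := by
        have : ∀ s' : Finset (ℕ × X × (X →L[ℂ] ℂ)),
            (s'.inf (fun p => LinearMap.ker (p.2.2 : X →ₗ[ℂ] ℂ))).CoFG := by
          intro s'
          induction s' using Finset.induction_on with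
          | empty => simp only [Finset.inf_empty]; exact Submodule.CoFG.top
          | insert a s' _ ih =>
            rw [Finset.inf_insert]
            exact Submodule.CoFG.inf (Submodule.CoFG.ker _) ih
        exact this s
      have hε : 0 < d / 4 * (1 / 4 : ℝ) ^ n := by positivity
      have hno : ¬ ∀ x ∈ M, d / 4 * (1 / 4 : ℝ) ^ n * ‖x‖ ≤ ‖A x‖ :=
        fun h => hA ⟨M, hMc, hMf, _, hε, h⟩
      push Not at hno
      obtain ⟨x, hxM, hx⟩ := hno
      have hx0 : x ≠ 0 := by
        rintro rfl
        simp at hx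
      have hxn : ‖x‖ ≠ 0 := norm_ne_zero_iff.2 hx0
      have hxpos : 0 < ‖x‖ := norm_pos_iff.2 hx0
      obtain ⟨φ, hφ1, hφ⟩ := exists_dual_vector ℂ x hxn
      refine ⟨⟨n, ((‖x‖ : ℂ)⁻¹) • x, φ⟩, ⟨?_, hφ1.le, ?_, ?_⟩, ?_⟩
      · simp [norm_smul, hxn]
      · simp only [map_smul, hφ, smul_eq_mul]
        exact inv_mul_cancel₀ (by exact_mod_cast hxn)
      · simp only [map_smul, norm_smul, norm_inv, Complex.norm_real, norm_norm]
        rw [inv_mul_eq_div, div_le_iff₀ hxpos]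
        exact hx.le
      · intro p hp
        refine ⟨Nat.lt_succ_of_le (Finset.le_sup (f := fun p => p.1) hp), ?_⟩
        simp only [map_smul, (hM x).1 hxM p hp, smul_zero])
  let x : ℕ → X := fun n => (g n).2.1
  let f : ℕ → (X →L[ℂ] ℂ) := fun n => (g n).2.2
  have hidx : ∀ n, n ≤ (g n).1 := by
    have : StrictMono fun n => (g n).1 := fun m n hmn => (hgr m n hmn).1
    exact fun n => this.le_apply
  have hAx : ∀ n, ‖A (x n)‖ ≤ d / 4 * (1 / 4) ^ n := fun n =>
    (hg n).2.2.2.trans (by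
      gcongr ?_ * ?_
      exact pow_le_pow_of_le_one (by norm_num) (by norm_num) (hidx n))
  have hcb := coeff_bound x f (fun n => (hg n).1) (fun n => (hg n).2.1) (fun n => (hg n).2.2.1)
    (fun m n hmn => (hgr m n hmn).2)
  have hsmall : ∀ (a : ℕ → ℂ) (N : ℕ),
      ‖A (∑ i ∈ Finset.range N, a i • x i)‖ ≤ d / 2 * ‖∑ i ∈ Finset.range N, a i • x i‖ := by
    intro a N
    have hb := hcb a N
    set z := ∑ i ∈ Finset.range N, a i • x i with hz
    calc ‖A z‖ ≤ ∑ i ∈ Finset.range N, ‖a i‖ * ‖A (x i)‖ := by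
          rw [hz, map_sum]
          refine (norm_sum_le _ _).trans (le_of_eq ?_)
          simp [norm_smul]
      _ ≤ ∑ i ∈ Finset.range N, (2 ^ i * ‖z‖) * (d / 4 * (1 / 4) ^ i) := by
          refine Finset.sum_le_sum fun i hi => ?_
          gcongr
          · exact hb i (Finset.mem_range.1 hi)
          · exact hAx i
      _ = d / 4 * ‖z‖ * ∑ i ∈ Finset.range N, (1 / 2 : ℝ) ^ i := by
          rw [Finset.mul_sum]
          refine Finset.sum_congr rfl fun i _ => ?_
          have : (1 / 2 : ℝ) ^ i = 2 ^ i * (1 / 4) ^ i := by rw [← mul_pow]; norm_num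
          rw [this]; ring
      _ ≤ d / 4 * ‖z‖ * 2 := by
          gcongr
          exact sum_geometric_two_le N
      _ = d / 2 * ‖z‖ := by ring
  have hli : LinearIndependent ℂ x := by
    rw [linearIndependent_iff']
    intro s a hs i hi
    let b : ℕ → ℂ := fun j => if j ∈ s then a j else 0
    obtain ⟨N, hN⟩ := s.exists_nat_subset_range
    have hsum : ∑ j ∈ Finset.range N, b j • x j = 0 := by
      rw [← hs]
      symm
      rw [← Finset.sum_subset hN]
      · refine Finset.sum_congr rfl fun j hj => ?_
        simp [b, hj]
      · intro j _ hj
        simp [b, hj]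
    have := hcb b N i (Finset.mem_range.1 (hN hi))
    rw [hsum, norm_zero, mul_zero] at this
    have hb0 := norm_le_zero_iff.1 this
    simpa [b, hi] using hb0
  let Z0 : Submodule ℂ X := Submodule.span ℂ (Set.range x)
  have hZ0 : ∀ z ∈ Z0, ‖A z‖ ≤ d / 2 * ‖z‖ := by
    intro z hz
    obtain ⟨c, rfl⟩ := Finsupp.mem_span_range_iff_exists_finsupp.1 hz
    obtain ⟨N, hN⟩ := c.support.exists_nat_subset_range
    have : (c.sum fun i a => a • x i) = ∑ i ∈ Finset.range N, c i • x i :=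
      Finsupp.sum_of_support_subset _ hN _ (by simp)
    rw [this]
    exact hsmall c N
  let Z := Z0.topologicalClosure
  have hZ : ∀ z ∈ Z, ‖A z‖ ≤ d / 2 * ‖z‖ := by
    have hcl : IsClosed {z : X | ‖A z‖ ≤ d / 2 * ‖z‖} :=
      isClosed_le (by fun_prop) (by fun_prop)
    intro z hz
    exact closure_minimal (s := (Z0 : Set X)) hZ0 hcl hz
  refine hS Z Z0.isClosed_topologicalClosure ?_ ⟨d / 2 / (|t| + 1), by positivity, ?_⟩
  · intro hfd
    have hxZ : ∀ n, x n ∈ Z := fun n =>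
      Z0.le_topologicalClosure (Submodule.subset_span ⟨n, rfl⟩)
    have hli' : LinearIndependent ℂ (fun n => (⟨x n, hxZ n⟩ : Z)) :=
      LinearIndependent.of_comp Z.subtype hli
    have := hli'.finite
    exact not_finite ℕ
  · intro z
    have h1 := hZ z z.2
    have h2 := hu (z : X)
    have h3 : ‖(u : X →L[ℂ] X) z‖ ≤ ‖A z‖ + |t| * ‖S z‖ := by
      have : (u : X →L[ℂ] X) z = A z - (t : ℂ) • S z := by simp [hAdef]
      rw [this]
      refine (norm_sub_le _ _).trans ?_
      simp [norm_smul]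
    rw [div_mul_eq_mul_div, div_le_iff₀ (by positivity)]
    nlinarith [norm_nonneg (S (z : X))]

end SSAux

/-- Let `T = D + S` with `S` strictly singular, and let
`λ ∈ σ(T)` with `λ ∉ σ_p(T) ∪ {0}`. Then `λ ∈ σ(D)`. -/
theorem spectrum_subset_of_strictlySingular_perturbation
    {X : Type*} [NormedAddCommGroup X] [NormedSpace ℂ X] [CompleteSpace X]
    (D S T : X →L[ℂ] X) (hS : StrictlySingular S) (hT : T = D + S)
    (lam : ℂ)
    (hsp : lam ∈ spectrum ℂ T)
    (hnp : ¬ ∃ x : X, x ≠ 0 ∧ T x = lam • x)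
    (h0 : lam ≠ 0) :
    lam ∈ spectrum ℂ D := by
  by_contra hD
  rw [spectrum.notMem_iff] at hD
  obtain ⟨u, hu⟩ := hD.neg
  let γ : ℝ → (X →L[ℂ] X) := fun t => (u : X →L[ℂ] X) + (t : ℂ) • S
  have hγ : Continuous γ := by fun_prop
  have husf : ∀ t, SSAux.USF (γ t) := SSAux.USF.of_strictlySingular u S hS
  have hclopen : IsClopen (γ ⁻¹' {A | SSAux.FZ A}) := by
    refine ⟨?_, SSAux.isOpen_FZ.preimage hγ⟩
    rw [← closure_subset_iff_isClosed]
    intro t ht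
    exact SSAux.FZ.of_closure _ (γ t) (husf t) rfl
      (map_mem_closure hγ ht fun s hs => hs)
  have h0mem : (0 : ℝ) ∈ γ ⁻¹' {A | SSAux.FZ A} := by
    refine ⟨0, ?_, ?_⟩
    · have h0 := (SSAux.FR.smulRight (0 : X →L[ℂ] ℂ) (0 : X))
      convert h0
      ext; simp
    · simp [γ]
  have h1 : SSAux.FZ (γ 1) := by
    rcases isClopen_iff.1 hclopen with h | h
    · rw [h] at h0mem; exact h0mem.elim
    · have : (1 : ℝ) ∈ γ ⁻¹' {A | SSAux.FZ A} := by rw [h]; trivial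
      exact this
  have hγ1 : γ 1 = -(algebraMap ℂ (X →L[ℂ] X) lam - T) := by
    simp only [γ, hu, hT]
    simp
    abel
  have hinj : Function.Injective (γ 1) := by
    rw [injective_iff_map_eq_zero]
    intro x hx
    by_contra hne
    refine hnp ⟨x, hne, ?_⟩
    rw [hγ1] at hx
    simpa [Algebra.algebraMap_eq_smul_one, sub_eq_zero] using hx
  have hunit : IsUnit (γ 1) :=
    ContinuousLinearMap.isUnit_iff_bijective.2 ⟨hinj, h1.alt.1 hinj⟩
  rw [hγ1, IsUnit.neg_iff] at hunit
  exact hsp hunit
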